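/- arXiv:2304.05532 — 8 statements merged into one kernel-verified Lean document; each statement's English description precedes it below -/
import Mathlib

section
/- For every integer N ≥ 3, the set Q_N = {1,2,…,N} with the operation x*y = x if y ≠ N; x*N = x+1 if x ≠ N−1 and x ≠ N; (N−1)*N = 1; N*N = N is a quandle: (i) x*x = x for all x ∈ Q_N; (ii) for each y ∈ Q_N the map x ↦ x*y is a bijection of Q_N; (iii) (x*y)*z = (x*z)*(y*z) for all x,y,z ∈ Q_N. Moreover the right-inverse operation \bar* (characterized by (x \bar* y)*y = x) is given by: x \bar* y = x if y ≠ N; x \bar* N = x−1 if x ≠ 1 and x ≠ N; 1 \bar* N = N−1; N \bar* N = N. -/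
/-- The binary operation of the quandle `Q_N = {1,…,N}` from Example 3.1:
`x*y = x` if `y ≠ N`; `x*N = x+1` if `x ≠ N-1, x ≠ N`; `(N-1)*N = 1`; `N*N = N`. -/
def qop (N x y : ℕ) : ℕ :=
  if y ≠ N then x
  else if x = N then N
  else if x = N - 1 then 1
  else x + 1

/-- The right-inverse operation `x \bar* y` of the quandle `Q_N`:
`x \bar* y = x` if `y ≠ N`; `x \bar* N = x-1` if `x ≠ 1, x ≠ N`; `1 \bar* N = N-1`; `N \bar* N = N`. -/
def qinv (N x y : ℕ) : ℕ :=
  if y ≠ N then x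
  else if x = N then N
  else if x = 1 then N - 1
  else x - 1

theorem qop_mem_Icc {N x : ℕ} (hN : 3 ≤ N) (y : ℕ) (hx : x ∈ Finset.Icc 1 N) :
    qop N x y ∈ Finset.Icc 1 N := by
  simp only [Finset.mem_Icc, qop] at *
  split_ifs <;> omega

theorem qinv_mem_Icc {N x : ℕ} (hN : 3 ≤ N) (y : ℕ) (hx : x ∈ Finset.Icc 1 N) :
    qinv N x y ∈ Finset.Icc 1 N := by
  simp only [Finset.mem_Icc, qinv] at *
  split_ifs <;> omega

theorem qop_qinv {N x : ℕ} (hN : 3 ≤ N) (y : ℕ) (hx : x ∈ Finset.Icc 1 N) :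
    qop N (qinv N x y) y = x := by
  simp only [Finset.mem_Icc, qop, qinv] at *
  split_ifs <;> omega

theorem qinv_qop {N x : ℕ} (hN : 3 ≤ N) (y : ℕ) (hx : x ∈ Finset.Icc 1 N) :
    qinv N (qop N x y) y = x := by
  simp only [Finset.mem_Icc, qop, qinv] at *
  split_ifs <;> omega

theorem qop_self (N x : ℕ) : qop N x x = x := by
  unfold qop
  split_ifs <;> omega

theorem qop_eq_right_iff {N : ℕ} (hN : 3 ≤ N) (y z : ℕ) : qop N y z = N ↔ y = N := by
  unfold qop
  split_ifs <;> omega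

theorem qop_right_distrib {N : ℕ} (hN : 3 ≤ N) (x y z : ℕ) :
    qop N (qop N x y) z = qop N (qop N x z) (qop N y z) := by
  by_cases hy : y = N
  · have h : qop N y z = N := (qop_eq_right_iff hN y z).2 hy
    rw [h, hy]
    by_cases hz : z = N
    · rw [hz]
    · simp [qop, hz]
  · have h : qop N y z ≠ N := mt (qop_eq_right_iff hN y z).1 hy
    have hfix (a b : ℕ) (hb : b ≠ N) : qop N a b = a := if_pos hb
    rw [hfix x y hy, hfix _ _ h]

/-- For every `N ≥ 3`, `Q_N = {1,…,N}` with the operation `qop N` is a quandle: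
(i) idempotence, (ii) right translations are bijections of `Q_N`, (iii) right
self-distributivity; moreover the right-inverse operation (characterized by
`(x \bar* y) * y = x`) is given by `qinv N`. -/
theorem quandle_QN (N : ℕ) (hN : 3 ≤ N) :
    (∀ x ∈ Finset.Icc 1 N, qop N x x = x) ∧
    (∀ y ∈ Finset.Icc 1 N,
      Set.BijOn (fun x => qop N x y) (Finset.Icc 1 N : Set ℕ) (Finset.Icc 1 N : Set ℕ)) ∧
    (∀ x ∈ Finset.Icc 1 N, ∀ y ∈ Finset.Icc 1 N, ∀ z ∈ Finset.Icc 1 N,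
      qop N (qop N x y) z = qop N (qop N x z) (qop N y z)) ∧
    (∀ x ∈ Finset.Icc 1 N, ∀ y ∈ Finset.Icc 1 N,
      qinv N x y ∈ Finset.Icc 1 N ∧ qop N (qinv N x y) y = x ∧ qinv N (qop N x y) y = x) := by
  refine ⟨fun x _ => qop_self N x, fun y _ => ?_, fun x _ y _ z _ => qop_right_distrib hN x y z,
    fun x hx y _ => ⟨qinv_mem_Icc hN y hx, qop_qinv hN y hx, qinv_qop hN y hx⟩⟩
  exact Set.InvOn.bijOn (f' := fun x => qinv N x y)
    ⟨fun x hx => qinv_qop hN y (by simpa using hx), fun x hx => qop_qinv hN y (by simpa using hx)⟩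
    (fun x hx => by simpa using qop_mem_Icc hN y (by simpa using hx))
    (fun x hx => by simpa using qinv_mem_Icc hN y (by simpa using hx))
end

section
/- (Lemma 4.1) Let N ≥ 3 and let φ : Q_N × Q_N → Q_N × Q_N be given by φ(a,b) = (b, a*b). Then: (a) the first coordinate of φ^{2k}(1,N) equals k+1 for k = 0,1,…,N−2, and equals 1 for k = N−1; (b) the second coordinate of φ^{2k}(1,N) equals N for k = 0,1,…,N−1; (c) the first coordinate of φ^{2k+1}(1,N) equals N for k = 0,1,…,N−2; (d) the second coordinate of φ^{2k+1}(1,N) equals k+2 for k = 0,1,…,N−3, and equals 1 for k = N−2. -/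
/-- The effect of `σ_i^{-1}` on the pair of entries `(a,b)`: `φ(a,b) = (b, a*b)`. -/
def phi (N : ℕ) (p : ℕ × ℕ) : ℕ × ℕ := (p.2, qop N p.1 p.2)

/-- The effect of `σ_i` on the pair of entries `(a,b)`: `ψ(a,b) = (b \bar* a, a)`. -/
def psi (N : ℕ) (p : ℕ × ℕ) : ℕ × ℕ := (qinv N p.2 p.1, p.1)

theorem phi_pair_right {N a : ℕ} (ha : a + 1 < N) : phi N (a, N) = (N, a + 1) := by
  have h₁ : a ≠ N := by omega
  have h₂ : a ≠ N - 1 := by omega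
  simp [phi, qop, h₁, h₂]

theorem phi_pred_pair {N : ℕ} (hN : 1 ≤ N) : phi N (N - 1, N) = (N, 1) := by
  have h : N - 1 ≠ N := by omega
  simp [phi, qop, h]

theorem phi_pair_left {N b : ℕ} (hb : b ≠ N) : phi N (N, b) = (b, N) := by
  simp [phi, qop, hb]

theorem phi_iterate_even {N k : ℕ} (hk : k + 1 < N) :
    (phi N)^[2 * k] (1, N) = (k + 1, N) := by
  induction k with
  | zero => rfl
  | succ k ih =>
    rw [show 2 * (k + 1) = 2 * k + 1 + 1 by ring, Function.iterate_succ_apply',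
      Function.iterate_succ_apply', ih (by omega), phi_pair_right (by omega),
      phi_pair_left (by omega)]

theorem phi_iterate_odd {N k : ℕ} (hk : k + 2 < N) :
    (phi N)^[2 * k + 1] (1, N) = (N, k + 2) := by
  rw [Function.iterate_succ_apply', phi_iterate_even (by omega), phi_pair_right (by omega)]

theorem phi_iterate_odd_last {N : ℕ} (hN : 2 ≤ N) :
    (phi N)^[2 * (N - 2) + 1] (1, N) = (N, 1) := by
  rw [Function.iterate_succ_apply', phi_iterate_even (by omega),
    show N - 2 + 1 = N - 1 by omega, phi_pred_pair (by omega)]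

theorem phi_iterate_period {N : ℕ} (hN : 2 ≤ N) :
    (phi N)^[2 * (N - 1)] (1, N) = (1, N) := by
  rw [show 2 * (N - 1) = 2 * (N - 2) + 1 + 1 by omega, Function.iterate_succ_apply',
    phi_iterate_odd_last hN, phi_pair_left (by omega)]

/-- Lemma 4.1: values of the iterates of `φ(a,b) = (b, a*b)` starting at `(1, N)`. -/
theorem lemma_4_1 (N : ℕ) (hN : 3 ≤ N) :
    ((∀ k ≤ N - 2, ((phi N)^[2 * k] (1, N)).1 = k + 1) ∧
      ((phi N)^[2 * (N - 1)] (1, N)).1 = 1) ∧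
    (∀ k ≤ N - 1, ((phi N)^[2 * k] (1, N)).2 = N) ∧
    (∀ k ≤ N - 2, ((phi N)^[2 * k + 1] (1, N)).1 = N) ∧
    ((∀ k ≤ N - 3, ((phi N)^[2 * k + 1] (1, N)).2 = k + 2) ∧
      ((phi N)^[2 * (N - 2) + 1] (1, N)).2 = 1) := by
  refine ⟨⟨fun k hk => ?_, ?_⟩, fun k hk => ?_, fun k hk => ?_, fun k hk => ?_, ?_⟩
  · rw [phi_iterate_even (by omega)]
  · rw [phi_iterate_period (by omega)]
  · rcases hk.eq_or_lt with rfl | hk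
    · rw [phi_iterate_period (by omega)]
    · rw [phi_iterate_even (by omega)]
  · rcases hk.eq_or_lt with rfl | hk
    · rw [phi_iterate_odd_last (by omega)]
    · rw [phi_iterate_odd (by omega)]
  · rw [phi_iterate_odd (by omega)]
  · rw [phi_iterate_odd_last (by omega)]
end

section
/- (Corollary 4.2) Let N ≥ 3 and let φ : Q_N × Q_N → Q_N × Q_N be given by φ(a,b) = (b, a*b). Let k ≥ 0 and write k = s + m(N−1) with integers s,m and 0 ≤ s ≤ N−2. Then: (a) the first coordinate of φ^{2k}(1,N) equals s+1; (b) the second coordinate of φ^{2k}(1,N) equals N; (c) the first coordinate of φ^{2k+1}(1,N) equals N; (d) the second coordinate of φ^{2k+1}(1,N) equals s+2 if s ≠ N−2, and equals 1 if s = N−2. -/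
theorem qop_self_left (N y : ℕ) : qop N N y = N := by
  simp [qop]

theorem qop_succ_right {N s : ℕ} (hs : s + 1 < N) :
    qop N (s + 1) N = if s = N - 2 then 1 else s + 2 := by
  unfold qop
  split_ifs <;> omega

theorem phi_phi (N a : ℕ) : phi N (phi N (a, N)) = (qop N a N, N) := by
  simp [phi, qop_self_left]

/-- On pairs with second entry `N`, the even iterates of `phi` count modulo `N - 1`. -/
theorem phi_iterate_two_mul {N : ℕ} (hN : 2 ≤ N) (k : ℕ) :
    (phi N)^[2 * k] (1, N) = (k % (N - 1) + 1, N) := by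
  induction k with
  | zero => simp
  | succ k ih =>
    have hlt : k % (N - 1) < N - 1 := Nat.mod_lt _ (by omega)
    rw [show 2 * (k + 1) = 2 * k + 1 + 1 by ring, Function.iterate_succ_apply',
      Function.iterate_succ_apply', ih, phi_phi, qop_succ_right (by omega),
      Nat.add_mod_eq_ite]
    rcases Nat.lt_or_ge N 3 with h | h
    · obtain rfl : N = 2 := by omega
      simp [Nat.mod_one]
    · rw [Nat.mod_eq_of_lt (show 1 < N - 1 by omega)]
      congr 1
      split_ifs <;> omega

/-- Corollary 4.2: values of the iterates of `φ(a,b) = (b, a*b)` starting at `(1, N)`,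
for arbitrary `k = s + m(N-1)` with `0 ≤ s ≤ N-2`. -/
theorem corollary_4_2 (N k s m : ℕ) (hN : 3 ≤ N) (hk : k = s + m * (N - 1))
    (hs : s ≤ N - 2) :
    ((phi N)^[2 * k] (1, N)).1 = s + 1 ∧
    ((phi N)^[2 * k] (1, N)).2 = N ∧
    ((phi N)^[2 * k + 1] (1, N)).1 = N ∧
    (s ≠ N - 2 → ((phi N)^[2 * k + 1] (1, N)).2 = s + 2) ∧
    (s = N - 2 → ((phi N)^[2 * k + 1] (1, N)).2 = 1) := by
  have hmod : k % (N - 1) = s := by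
    rw [hk, Nat.add_mul_mod_self_right, Nat.mod_eq_of_lt (by omega)]
  have heven := phi_iterate_two_mul (show 2 ≤ N by omega) k
  rw [hmod] at heven
  rw [Function.iterate_succ_apply', heven]
  simp only [phi, qop_succ_right (show s + 1 < N by omega)]
  refine ⟨trivial, trivial, trivial, fun h => if_neg h, fun h => if_pos h⟩
end

section
/- (Lemma 7.4) Let N ≥ 3 and define f : Q_N → Q_N by f(x) = x+1 if x < N−1, f(N−1) = 1, and f(N) = N. Then f is a quandle homomorphism, i.e. f(x*y) = f(x)*f(y) for all x,y ∈ Q_N. Moreover f is a bijection whose inverse f^{-1}, given by f^{-1}(x) = x−1 if 1 < x ≤ N−1, f^{-1}(1) = N−1, and f^{-1}(N) = N, is also a quandle homomorphism. -/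
/-- The map `f : Q_N → Q_N` of Lemma 7.4: `f(x) = x+1` if `x < N-1`, `f(N-1) = 1`, `f(N) = N`. -/
def qf (N x : ℕ) : ℕ :=
  if x < N - 1 then x + 1
  else if x = N - 1 then 1
  else N

/-- The inverse map `f⁻¹ : Q_N → Q_N` of Lemma 7.4:
`f⁻¹(x) = x-1` if `1 < x ≤ N-1`, `f⁻¹(1) = N-1`, `f⁻¹(N) = N`. -/
def qfInv (N x : ℕ) : ℕ :=
  if x = 1 then N - 1
  else if x ≤ N - 1 then x - 1
  else N

/-- Lemma 7.4: `f` is a quandle homomorphism of `Q_N`, it is a bijection of `Q_N`,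
and its inverse `f⁻¹` is also a quandle homomorphism. -/
theorem lemma_7_4 (N : ℕ) (hN : 3 ≤ N) :
    (∀ x ∈ Finset.Icc 1 N, ∀ y ∈ Finset.Icc 1 N,
      qf N (qop N x y) = qop N (qf N x) (qf N y)) ∧
    Set.BijOn (qf N) (Finset.Icc 1 N : Set ℕ) (Finset.Icc 1 N : Set ℕ) ∧
    (∀ x ∈ Finset.Icc 1 N, qfInv N (qf N x) = x ∧ qf N (qfInv N x) = x) ∧
    (∀ x ∈ Finset.Icc 1 N, ∀ y ∈ Finset.Icc 1 N,
      qfInv N (qop N x y) = qop N (qfInv N x) (qfInv N y)) := by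
  have hf : ∀ x, 1 ≤ x → x ≤ N → 1 ≤ qf N x ∧ qf N x ≤ N := by
    intro x h1 h2
    unfold qf
    split_ifs <;> omega
  have hg : ∀ x, 1 ≤ x → x ≤ N → 1 ≤ qfInv N x ∧ qfInv N x ≤ N := by
    intro x h1 h2
    unfold qfInv
    split_ifs <;> omega
  have hgf : ∀ x, 1 ≤ x → x ≤ N → qfInv N (qf N x) = x := by
    intro x h1 h2
    unfold qf qfInv
    grind
  have hfg : ∀ x, 1 ≤ x → x ≤ N → qf N (qfInv N x) = x := by
    intro x h1 h2
    unfold qf qfInv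
    grind
  simp only [Finset.mem_Icc, Finset.coe_Icc]
  refine ⟨?_, ?_, fun x hx => ⟨hgf x hx.1 hx.2, hfg x hx.1 hx.2⟩, ?_⟩
  · rintro x ⟨hx1, hx2⟩ y ⟨hy1, hy2⟩
    unfold qop qf
    grind
  · exact Set.InvOn.bijOn (f' := qfInv N)
      ⟨fun x hx => hgf x hx.1 hx.2, fun x hx => hfg x hx.1 hx.2⟩
      (fun x hx => hf x hx.1 hx.2) (fun x hx => hg x hx.1 hx.2)
  · rintro x ⟨hx1, hx2⟩ y ⟨hy1, hy2⟩
    unfold qop qfInv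
    grind
end

section
/- (Computational content of Lemma 8.1) Let N ≥ 3 and k ≥ 0, and consider the braid-generator maps on Q_N^4. Let a = (1,1,N,N) and let c = β_1(β_2(β_2(a))) (the action of the word σ_1σ_2^2 on a). Then: (a) the tuple (β_2⁻)^2(c) (the word σ_2^{-2}σ_1σ_2^2) has equal 3rd and 4th coordinates; (b) if k ≡ 2N−5 (mod 2(N−1)), then the tuple (β_2⁻)^{k+1}(c) (the word σ_2^{-(k+1)}σ_1σ_2^2) has equal 1st and 2nd coordinates; (c) if k ≢ 2N−5 (mod 2(N−1)), then the tuple (β_2⁻)^{k+1}(c) has distinct 1st and 2nd coordinates. -/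
/-- Coloring tuples in `Q_N^4`. -/
abbrev Quad := ℕ × ℕ × ℕ × ℕ

/-- Action of the braid generator `σ_1` on `Q_N^4`: replaces `(a₁,a₂)` by `(a₂ \bar* a₁, a₁)`. -/
def b1 (N : ℕ) (a : Quad) : Quad := (qinv N a.2.1 a.1, a.1, a.2.2.1, a.2.2.2)

/-- Action of `σ_1^{-1}` on `Q_N^4`: replaces `(a₁,a₂)` by `(a₂, a₁ * a₂)`. -/
def b1inv (N : ℕ) (a : Quad) : Quad := (a.2.1, qop N a.1 a.2.1, a.2.2.1, a.2.2.2)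

/-- Action of `σ_2` on `Q_N^4`: replaces `(a₂,a₃)` by `(a₃ \bar* a₂, a₂)`. -/
def b2 (N : ℕ) (a : Quad) : Quad := (a.1, qinv N a.2.2.1 a.2.1, a.2.1, a.2.2.2)

/-- Action of `σ_2^{-1}` on `Q_N^4`: replaces `(a₂,a₃)` by `(a₃, a₂ * a₃)`. -/
def b2inv (N : ℕ) (a : Quad) : Quad := (a.1, a.2.2.1, qop N a.2.1 a.2.2.1, a.2.2.2)

/-- Action of `σ_3` on `Q_N^4`: replaces `(a₃,a₄)` by `(a₄ \bar* a₃, a₃)`. -/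
def b3 (N : ℕ) (a : Quad) : Quad := (a.1, a.2.1, qinv N a.2.2.2 a.2.2.1, a.2.2.1)

/-- Action of `σ_3^{-1}` on `Q_N^4`: replaces `(a₃,a₄)` by `(a₄, a₃ * a₄)`. -/
def b3inv (N : ℕ) (a : Quad) : Quad := (a.1, a.2.1, a.2.2.2, qop N a.2.2.1 a.2.2.2)

theorem b1_b2_b2_start {N : ℕ} (hN : 3 ≤ N) :
    b1 N (b2 N (b2 N (1, 1, N, N))) = (N - 1, 1, N, N) := by
  have h1 : 1 ≠ N := by omega
  simp [b1, b2, qinv, h1]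

theorem qop_mod_add_one {N : ℕ} (hN : 3 ≤ N) (j : ℕ) :
    qop N (j % (N - 1) + 1) N = (j + 1) % (N - 1) + 1 := by
  have hlt : j % (N - 1) < N - 1 := Nat.mod_lt _ (by omega)
  rw [Nat.add_mod_eq_ite, Nat.mod_eq_of_lt (show 1 < N - 1 by omega)]
  unfold qop
  split_ifs <;> omega

theorem b2inv_iterate_even {N : ℕ} (hN : 3 ≤ N) (j : ℕ) :
    (b2inv N)^[2 * j] (N - 1, 1, N, N) = (N - 1, j % (N - 1) + 1, N, N) := by
  induction j with
  | zero => simp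
  | succ j ih =>
    have hlt : (j + 1) % (N - 1) < N - 1 := Nat.mod_lt _ (by omega)
    have hne : (j + 1) % (N - 1) + 1 ≠ N := by omega
    rw [show 2 * (j + 1) = 2 * j + 1 + 1 by ring, Function.iterate_succ_apply',
      Function.iterate_succ_apply', ih]
    simp only [b2inv, qop_mod_add_one hN]
    rw [qop, if_pos hne]

theorem b2inv_iterate_odd {N : ℕ} (hN : 3 ≤ N) (j : ℕ) :
    (b2inv N)^[2 * j + 1] (N - 1, 1, N, N) = (N - 1, N, (j + 1) % (N - 1) + 1, N) := by
  rw [Function.iterate_succ_apply', b2inv_iterate_even hN]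
  simp only [b2inv, qop_mod_add_one hN]

theorem b2inv_iterate_fst_eq_snd_iff {N : ℕ} (hN : 3 ≤ N) (k : ℕ) :
    ((b2inv N)^[k + 1] (N - 1, 1, N, N)).1 = ((b2inv N)^[k + 1] (N - 1, 1, N, N)).2.1 ↔
      k % (2 * (N - 1)) = 2 * N - 5 := by
  obtain ⟨m, rfl | rfl⟩ := k.even_or_odd'
  · rw [b2inv_iterate_odd hN, Nat.mul_mod_mul_left]
    dsimp only
    omega
  · have hlt : m % (N - 1) < N - 1 := Nat.mod_lt _ (by omega)
    have hmod : (2 * m + 1) % (2 * (N - 1)) = 2 * (m % (N - 1)) + 1 := by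
      rw [Nat.add_mod_eq_ite, Nat.mul_mod_mul_left,
        Nat.mod_eq_of_lt (show 1 < 2 * (N - 1) by omega)]
      split_ifs <;> omega
    rw [show 2 * m + 1 + 1 = 2 * (m + 1) by ring, b2inv_iterate_even hN, hmod,
      Nat.add_mod_eq_ite, Nat.mod_eq_of_lt (show 1 < N - 1 by omega)]
    dsimp only
    split_ifs <;> omega

/-- Computational content of Lemma 8.1: with `a = (1,1,N,N)` and
`c = β_1(β_2(β_2(a)))` (the word `σ_1σ_2²`):
(a) `σ_2^{-2}σ_1σ_2²` gives equal 3rd and 4th coordinates;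
(b) if `k ≡ 2N-5 (mod 2(N-1))`, then `σ_2^{-(k+1)}σ_1σ_2²` gives equal 1st and 2nd coordinates;
(c) otherwise they are distinct. -/
theorem lemma_8_1 (N k : ℕ) (hN : 3 ≤ N) :
    ((b2inv N)^[2] (b1 N (b2 N (b2 N (1, 1, N, N))))).2.2.1 =
      ((b2inv N)^[2] (b1 N (b2 N (b2 N (1, 1, N, N))))).2.2.2 ∧
    (k % (2 * (N - 1)) = 2 * N - 5 →
      ((b2inv N)^[k + 1] (b1 N (b2 N (b2 N (1, 1, N, N))))).1 =
        ((b2inv N)^[k + 1] (b1 N (b2 N (b2 N (1, 1, N, N))))).2.1) ∧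
    (k % (2 * (N - 1)) ≠ 2 * N - 5 →
      ((b2inv N)^[k + 1] (b1 N (b2 N (b2 N (1, 1, N, N))))).1 ≠
        ((b2inv N)^[k + 1] (b1 N (b2 N (b2 N (1, 1, N, N))))).2.1) := by
  rw [b1_b2_b2_start hN]
  refine ⟨?_, (b2inv_iterate_fst_eq_snd_iff hN k).mpr,
    mt (b2inv_iterate_fst_eq_snd_iff hN k).mp⟩
  have h := b2inv_iterate_even hN 1
  rw [mul_one] at h
  rw [h]
end

section
/- (Computational content of Lemma 8.5) Let N ≥ 3 and k ≥ 0, let s,t ∈ Q_N with s ≠ N and t ≠ N, and consider the braid-generator maps on Q_N^4. Let a = (s,s,t,t) and let c = β_1(β_2(β_2(a))) (the action of the word σ_1σ_2^2 on a). Then: (a) if k is odd, the tuple (β_2⁻)^{k+1}(c) (the word σ_2^{-(k+1)}σ_1σ_2^2) has equal 1st and 2nd coordinates; (b) if k is even and s ≠ t, the tuple (β_2⁻)^{k+1}(c) has distinct 1st and 2nd coordinates; (c) the tuple (β_2⁻)^2(c) (the word σ_2^{-2}σ_1σ_2^2) has equal 3rd and 4th coordinates. -/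
theorem b2inv_of_ne {N s t : ℕ} (ht : t ≠ N) (u v : ℕ) :
    b2inv N (u, s, t, v) = (u, t, s, v) := by
  simp [b2inv, qop, ht]

theorem b2inv_iterate_two_mul {N s t : ℕ} (hs : s ≠ N) (ht : t ≠ N) (u v m : ℕ) :
    (b2inv N)^[2 * m] (u, s, t, v) = (u, s, t, v) := by
  rw [Function.iterate_mul]
  exact Function.iterate_fixed (by simp [b2inv_of_ne, hs, ht]) m

theorem b1_b2_b2_of_ne {N s t : ℕ} (hs : s ≠ N) (ht : t ≠ N) :
    b1 N (b2 N (b2 N (s, s, t, t))) = (s, s, t, t) := by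
  simp [b1, b2, qinv, hs, ht]

/-- Computational content of Lemma 8.5: with `s, t ≠ N` in `Q_N`, `a = (s,s,t,t)` and
`c = β_1(β_2(β_2(a)))` (the word `σ_1σ_2²`):
(a) if `k` is odd, `σ_2^{-(k+1)}σ_1σ_2²` gives equal 1st and 2nd coordinates;
(b) if `k` is even and `s ≠ t`, they are distinct;
(c) `σ_2^{-2}σ_1σ_2²` gives equal 3rd and 4th coordinates. -/
theorem lemma_8_5 (N k s t : ℕ) (hN : 3 ≤ N) (hs : s ∈ Finset.Icc 1 N)
    (ht : t ∈ Finset.Icc 1 N) (hsN : s ≠ N) (htN : t ≠ N) :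
    (Odd k →
      ((b2inv N)^[k + 1] (b1 N (b2 N (b2 N (s, s, t, t))))).1 =
        ((b2inv N)^[k + 1] (b1 N (b2 N (b2 N (s, s, t, t))))).2.1) ∧
    (Even k → s ≠ t →
      ((b2inv N)^[k + 1] (b1 N (b2 N (b2 N (s, s, t, t))))).1 ≠
        ((b2inv N)^[k + 1] (b1 N (b2 N (b2 N (s, s, t, t))))).2.1) ∧
    ((b2inv N)^[2] (b1 N (b2 N (b2 N (s, s, t, t))))).2.2.1 =
      ((b2inv N)^[2] (b1 N (b2 N (b2 N (s, s, t, t))))).2.2.2 := by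
  rw [b1_b2_b2_of_ne hsN htN]
  refine ⟨?_, ?_, ?_⟩
  · rintro ⟨m, rfl⟩
    rw [show 2 * m + 1 + 1 = 2 * (m + 1) by ring, b2inv_iterate_two_mul hsN htN]
  · intro hk hst
    obtain ⟨m, rfl⟩ := hk.two_dvd
    rwa [Function.iterate_succ_apply', b2inv_iterate_two_mul hsN htN, b2inv_of_ne htN]
  · rw [b2inv_iterate_two_mul hsN htN s t 1]
end

section
/- (Computational content of Lemma 9.1) Let k ≥ 1 and N = k+2, and consider the braid-generator maps on Q_N^4. Let a = (1,1,N,N). Then the following equalities hold: (i) the tuple (β_2⁻)^{2k}(β_1(β_2(β_2(a)))) (the word σ_2^{-2k}σ_1σ_2^2) has equal 1st and 2nd coordinates; (ii) the tuple (β_2⁻)^2(β_1(β_2(β_2(a)))) (the word σ_2^{-2}σ_1σ_2^2) has equal 3rd and 4th coordinates; (iii) the tuple (β_2⁻)^{2k}(β_3(β_1(β_2(β_2(a))))) (the word σ_2^{-2k}σ_3σ_1σ_2^2) has equal 1st and 2nd coordinates and equal 3rd and 4th coordinates; (iv) the tuple (β_2⁻)^2(β_3(β_2(β_2(a)))) (the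 word σ_2^{-2}σ_3σ_2^2) has equal 1st and 2nd coordinates; (v) the tuple (β_2⁻)^{2k}(β_3(β_2(β_2(a)))) (the word σ_2^{-2k}σ_3σ_2^2) has equal 3rd and 4th coordinates. (These are exactly the defining relations of the knot quandle of the surface braid S_{2k−1} described by the chart T_{2k−1}, so the tuple (1,1,k+2,k+2) defines a Q_{k+2}-coloring.) -/
theorem qop_right_of_lt {N x : ℕ} (h : x + 1 < N) : qop N x N = x + 1 := by
  grind [qop]

/-- `σ_2^{-2}` acts on a tuple `(p, x, N, q)` with `x ≠ N` by `x ↦ x * N`. -/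
theorem b2inv_iterate_two {N x : ℕ} (h : qop N x N ≠ N) (p q : ℕ) :
    (b2inv N)^[2] (p, x, N, q) = (p, qop N x N, N, q) := by
  have hfix : qop N N (qop N x N) = N := by rw [qop, if_pos h]
  simp [b2inv, hfix]

theorem b2inv_iterate_two_mul_s17 {N j : ℕ} (h : j + 1 < N) (p q : ℕ) :
    (b2inv N)^[2 * j] (p, 1, N, q) = (p, j + 1, N, q) := by
  induction j with
  | zero => rfl
  | succ j ih =>
    have hq := qop_right_of_lt h
    rw [mul_add_one, add_comm, Function.iterate_add_apply, ih (by omega),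
      b2inv_iterate_two (by omega), hq]

/-- Computational content of Lemma 9.1: for `k ≥ 1` and `N = k+2`, the tuple
`a = (1,1,N,N)` satisfies the defining relations of the knot quandle of the surface
braid `S_{2k-1}` (the words `σ_2^{-2k}σ_1σ_2²`, `σ_2^{-2}σ_1σ_2²`, `σ_2^{-2k}σ_3σ_1σ_2²`,
`σ_2^{-2}σ_3σ_2²`, `σ_2^{-2k}σ_3σ_2²`). -/
theorem lemma_9_1 (k : ℕ) (hk : 1 ≤ k) (N : ℕ) (hN : N = k + 2) :
    ((b2inv N)^[2 * k] (b1 N (b2 N (b2 N (1, 1, N, N))))).1 =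
      ((b2inv N)^[2 * k] (b1 N (b2 N (b2 N (1, 1, N, N))))).2.1 ∧
    ((b2inv N)^[2] (b1 N (b2 N (b2 N (1, 1, N, N))))).2.2.1 =
      ((b2inv N)^[2] (b1 N (b2 N (b2 N (1, 1, N, N))))).2.2.2 ∧
    (((b2inv N)^[2 * k] (b3 N (b1 N (b2 N (b2 N (1, 1, N, N)))))).1 =
        ((b2inv N)^[2 * k] (b3 N (b1 N (b2 N (b2 N (1, 1, N, N)))))).2.1 ∧
      ((b2inv N)^[2 * k] (b3 N (b1 N (b2 N (b2 N (1, 1, N, N)))))).2.2.1 =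
        ((b2inv N)^[2 * k] (b3 N (b1 N (b2 N (b2 N (1, 1, N, N)))))).2.2.2) ∧
    ((b2inv N)^[2] (b3 N (b2 N (b2 N (1, 1, N, N))))).1 =
      ((b2inv N)^[2] (b3 N (b2 N (b2 N (1, 1, N, N))))).2.1 ∧
    ((b2inv N)^[2 * k] (b3 N (b2 N (b2 N (1, 1, N, N))))).2.2.1 =
      ((b2inv N)^[2 * k] (b3 N (b2 N (b2 N (1, 1, N, N))))).2.2.2 := by
  obtain ⟨m, rfl⟩ : ∃ m, k = m + 1 := ⟨k - 1, by omega⟩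
  have h₂ : b2 N (b2 N (1, 1, N, N)) = (1, N - 1, N, N) := by
    grind [b2, qinv]
  have h₁ : b1 N (1, N - 1, N, N) = (N - 1, 1, N, N) := by
    grind [b1, qinv]
  have h₃ (p x : ℕ) : b3 N (p, x, N, N) = (p, x, N, N) := by
    grind [b3, qinv]
  have hwrap : qop N (N - 1) N = 1 := by
    grind [qop]
  have hlast : (b2inv N)^[2] (1, N - 1, N, N) = (1, 1, N, N) := by
    rw [b2inv_iterate_two (by omega), hwrap]
  have hfirst : (b2inv N)^[2] (N - 1, 1, N, N) = (N - 1, 2, N, N) :=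
    b2inv_iterate_two_mul_s17 (j := 1) (by omega) _ _
  have hcycle : (b2inv N)^[2 * (m + 1)] (1, N - 1, N, N) = (1, m + 1, N, N) := by
    rw [mul_add_one, Function.iterate_add_apply, hlast, b2inv_iterate_two_mul_s17 (by omega)]
  rw [h₂, h₁, h₃, h₃, b2inv_iterate_two_mul_s17 (by omega), hlast, hfirst, hcycle]
  refine ⟨?_, rfl, ⟨?_, rfl⟩, rfl, rfl⟩ <;> dsimp only <;> omega
end

section
/- (Computational content of Lemma 9.2) Let k ≥ 1 and N = k+2, and consider the braid-generator maps on Q_N^4. Let a = (N,N,1,1). Then the following equalities hold: (i) the tuple (β_2⁻)^{2k}(β_1(β_2(β_2(a)))) (the word σ_2^{-2k}σ_1σ_2^2) has equal 1st and 2nd coordinates; (ii) the tuple (β_2⁻)^2(β_1(β_2(β_2(a)))) (the word σ_2^{-2}σ_1σ_2^2) has equal 3rd and 4th coordinates; (iii) the tuple (β_2⁻)^{2k}(β_3(β_1(β_2(β_2(a))))) (the word σ_2^{-2k}σ_3σ_1σ_2^2) has equal 1st and 2nd coordinates and equal 3rd and 4th coordinates; (iv) the tuple (β_2⁻)^2(β_3(β_2(β_2(a))))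 (the word σ_2^{-2}σ_3σ_2^2) has equal 1st and 2nd coordinates; (v) the tuple (β_2⁻)^{2k}(β_3(β_2(β_2(a)))) (the word σ_2^{-2k}σ_3σ_2^2) has equal 3rd and 4th coordinates. (These are exactly the defining relations of the knot quandle of the surface braid S_{2k−1} described by the chart T_{2k−1}, so the tuple (k+2,k+2,1,1) defines a Q_{k+2}-coloring.) -/
/-- The square of `σ_2^{-1}` fixes a middle coordinate `N` and moves `x` to `x * N`. -/
theorem b2inv_two_iterate (N c x d : ℕ) (hx : x ≠ N) :
    (b2inv N)^[2] (c, N, x, d) = (c, N, qop N x N, d) := by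
  simp [b2inv, qop, hx]

theorem b2inv_two_mul_iterate (N c x d n : ℕ) (h : x + n < N) :
    (b2inv N)^[2 * n] (c, N, x, d) = (c, N, x + n, d) := by
  induction n with
  | zero => simp
  | succ n ih =>
    rw [Nat.mul_succ, Nat.add_comm, Function.iterate_add_apply, ih (by omega),
      b2inv_two_iterate _ _ _ _ (by omega)]
    have h₁ : x + n ≠ N := by omega
    have h₂ : x + n ≠ N - 1 := by omega
    simp [qop, h₁, h₂, Nat.add_assoc]

/-- Computational content of Lemma 9.2: for `k ≥ 1` and `N = k+2`, the tuple
`a = (N,N,1,1)` satisfies the defining relations of the knot quandle of the surface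
braid `S_{2k-1}` (the words `σ_2^{-2k}σ_1σ_2²`, `σ_2^{-2}σ_1σ_2²`, `σ_2^{-2k}σ_3σ_1σ_2²`,
`σ_2^{-2}σ_3σ_2²`, `σ_2^{-2k}σ_3σ_2²`). -/
theorem lemma_9_2 (k : ℕ) (hk : 1 ≤ k) (N : ℕ) (hN : N = k + 2) :
    ((b2inv N)^[2 * k] (b1 N (b2 N (b2 N (N, N, 1, 1))))).1 =
      ((b2inv N)^[2 * k] (b1 N (b2 N (b2 N (N, N, 1, 1))))).2.1 ∧
    ((b2inv N)^[2] (b1 N (b2 N (b2 N (N, N, 1, 1))))).2.2.1 =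
      ((b2inv N)^[2] (b1 N (b2 N (b2 N (N, N, 1, 1))))).2.2.2 ∧
    (((b2inv N)^[2 * k] (b3 N (b1 N (b2 N (b2 N (N, N, 1, 1)))))).1 =
        ((b2inv N)^[2 * k] (b3 N (b1 N (b2 N (b2 N (N, N, 1, 1)))))).2.1 ∧
      ((b2inv N)^[2 * k] (b3 N (b1 N (b2 N (b2 N (N, N, 1, 1)))))).2.2.1 =
        ((b2inv N)^[2 * k] (b3 N (b1 N (b2 N (b2 N (N, N, 1, 1)))))).2.2.2) ∧
    ((b2inv N)^[2] (b3 N (b2 N (b2 N (N, N, 1, 1))))).1 =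
      ((b2inv N)^[2] (b3 N (b2 N (b2 N (N, N, 1, 1))))).2.1 ∧
    ((b2inv N)^[2 * k] (b3 N (b2 N (b2 N (N, N, 1, 1))))).2.2.1 =
      ((b2inv N)^[2 * k] (b3 N (b2 N (b2 N (N, N, 1, 1))))).2.2.2 := by
  subst hN
  have hb2 : b2 (k + 2) (b2 (k + 2) (k + 2, k + 2, 1, 1)) = (k + 2, k + 2, k + 1, 1) := by
    simp [b2, qinv]
  have hb1 (x d : ℕ) : b1 (k + 2) (k + 2, k + 2, x, d) = (k + 2, k + 2, x, d) := by
    simp [b1, qinv]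
  have hb3 : b3 (k + 2) (k + 2, k + 2, k + 1, 1) = (k + 2, k + 2, 1, k + 1) := by
    simp [b3, qinv]
  have htwo : (b2inv (k + 2))^[2] (k + 2, k + 2, k + 1, 1) = (k + 2, k + 2, 1, 1) := by
    rw [b2inv_two_iterate _ _ _ _ (by omega)]
    simp [qop]
  have hlow : (b2inv (k + 2))^[2 * k] (k + 2, k + 2, k + 1, 1) = (k + 2, k + 2, k, 1) := by
    obtain ⟨m, rfl⟩ := Nat.exists_eq_add_of_le' hk
    rw [Nat.mul_succ, Function.iterate_add_apply, htwo,
      b2inv_two_mul_iterate _ _ _ _ _ (by omega), Nat.add_comm 1 m]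
  have hhigh : (b2inv (k + 2))^[2 * k] (k + 2, k + 2, 1, k + 1) =
      (k + 2, k + 2, k + 1, k + 1) := by
    rw [b2inv_two_mul_iterate _ _ _ _ _ (by omega), Nat.add_comm 1 k]
  rw [hb2, hb1, hb3, htwo, hlow, hhigh, b2inv_two_iterate _ _ _ _ (by omega)]
  exact ⟨rfl, rfl, ⟨rfl, rfl⟩, rfl, rfl⟩
end
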